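/- arXiv:1410.7206 — 3 statements merged into one kernel-verified Lean document; each statement's English description precedes it below -/
import Mathlib

section
/- The numbers u_± := (ξ−2κρ±η)/(2ξ(1−ρ²)) satisfy u_− < 0 and u_+ ≥ 1, with u_+ = 1 if and only if ρ = κ/ξ; moreover the quadratic (κ−ρξu)² + u(1−u)ξ² is strictly positive for u ∈ (u_−, u_+) and vanishes at u = u_− and u = u_+. -/
open Real Set Filter Asymptotics

noncomputable section

namespace Heston

def dd (κ ξ ρ u : ℝ) : ℝ := Real.sqrt ((κ - ρ*ξ*u)^2 + u*(1-u)*ξ^2)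

def mu (κ θ ξ : ℝ) : ℝ := 2*κ*θ/ξ^2

def VV (κ θ ξ ρ u : ℝ) : ℝ := mu κ θ ξ / 2 * (κ - ρ*ξ*u - dd κ ξ ρ u)

def gam (κ ξ ρ u : ℝ) : ℝ := (κ - ρ*ξ*u - dd κ ξ ρ u) / (κ - ρ*ξ*u + dd κ ξ ρ u)

def bet (κ ξ t : ℝ) : ℝ := ξ^2/(4*κ) * (1 - Real.exp (-(κ*t)))

def HH (κ θ ξ ρ v t u : ℝ) : ℝ :=
  VV κ θ ξ ρ u * v * Real.exp (-(κ*t)) / (κ*θ - 2 * bet κ ξ t * VV κ θ ξ ρ u)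
  - mu κ θ ξ * Real.log ((κ*θ - 2 * bet κ ξ t * VV κ θ ξ ρ u) / (κ*θ*(1 - gam κ ξ ρ u)))

def eta (κ ξ ρ : ℝ) : ℝ := Real.sqrt (ξ^2*(1-ρ^2) + (2*κ - ρ*ξ)^2)

def uplus (κ ξ ρ : ℝ) : ℝ := (ξ - 2*κ*ρ + eta κ ξ ρ) / (2*ξ*(1-ρ^2))

def uminus (κ ξ ρ : ℝ) : ℝ := (ξ - 2*κ*ρ - eta κ ξ ρ) / (2*ξ*(1-ρ^2))

def psi (κ ξ ρ t : ℝ) : ℝ := ξ*(Real.exp (κ*t) - 1) - 4*κ*ρ*Real.exp (κ*t)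

def nuu (κ ξ ρ t : ℝ) : ℝ := Real.sqrt ((psi κ ξ ρ t)^2 - 16*κ^2*Real.exp (κ*t))

def ustarplus (κ ξ ρ t : ℝ) : ℝ := (psi κ ξ ρ t + nuu κ ξ ρ t) / (2*ξ*(Real.exp (κ*t) - 1))

def ustarminus (κ ξ ρ t : ℝ) : ℝ := (psi κ ξ ρ t - nuu κ ξ ρ t) / (2*ξ*(Real.exp (κ*t) - 1))

def rhoplus (κ ξ t : ℝ) : ℝ :=
  Real.exp (-(2*κ*t)) * (ξ*(Real.exp (2*κ*t) - 1)
    + (Real.exp (κ*t) + 1) * Real.sqrt (16*κ^2*Real.exp (2*κ*t) + ξ^2*(1 - Real.exp (κ*t))^2)) / (8*κ)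

def rhominus (κ ξ t : ℝ) : ℝ :=
  Real.exp (-(2*κ*t)) * (ξ*(Real.exp (2*κ*t) - 1)
    - (Real.exp (κ*t) + 1) * Real.sqrt (16*κ^2*Real.exp (2*κ*t) + ξ^2*(1 - Real.exp (κ*t))^2)) / (8*κ)

def R1 (κ ξ ρ t : ℝ) : Prop := rhominus κ ξ t ≤ ρ ∧ ρ ≤ min (rhoplus κ ξ t) (κ/ξ)
def R2 (κ ξ ρ t : ℝ) : Prop := -1 < ρ ∧ ρ < rhominus κ ξ t
def R3a (κ ξ ρ t : ℝ) : Prop := rhoplus κ ξ t < ρ ∧ ρ < 1 ∧ ρ ≤ κ/ξ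
def R3b (κ ξ ρ t : ℝ) : Prop := rhoplus κ ξ t < ρ ∧ ρ < 1 ∧ κ/ξ < ρ
def R4 (κ ξ ρ t : ℝ) : Prop := κ/ξ < ρ ∧ ρ ≤ min (rhoplus κ ξ t) 1

def D1 (κ ξ ρ : ℝ) : Set ℝ := Set.Icc (uminus κ ξ ρ) (uplus κ ξ ρ)
def D2 (κ ξ ρ t : ℝ) : Set ℝ := Set.Ico (uminus κ ξ ρ) (ustarplus κ ξ ρ t)
def D3a (κ ξ ρ t : ℝ) : Set ℝ := Set.Ioc (ustarminus κ ξ ρ t) (uplus κ ξ ρ)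
def D3b (κ ξ ρ t : ℝ) : Set ℝ := Set.Ioc (ustarminus κ ξ ρ t) 1
def D4 (κ ξ ρ : ℝ) : Set ℝ := Set.Ioc (uminus κ ξ ρ) 1

def regimeD (κ ξ ρ t : ℝ) (D : Set ℝ) : Prop :=
  (R1 κ ξ ρ t ∧ D = D1 κ ξ ρ) ∨ (R2 κ ξ ρ t ∧ D = D2 κ ξ ρ t) ∨
  (R3a κ ξ ρ t ∧ D = D3a κ ξ ρ t) ∨ (R3b κ ξ ρ t ∧ D = D3b κ ξ ρ t) ∨
  (R4 κ ξ ρ t ∧ D = D4 κ ξ ρ)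

def Vstar (κ θ ξ ρ : ℝ) (D : Set ℝ) (k : ℝ) : ℝ :=
  sSup ((fun u => u*k - VV κ θ ξ ρ u) '' D)

def ZZ (κ θ ξ ρ k : ℝ) : ℝ :=
  if k < deriv (VV κ θ ξ ρ) 0 then -1
  else if k ≤ deriv (VV κ θ ξ ρ) 1 then 1
  else if κ ≤ ρ*ξ then 1 else -1

def v0inf (κ θ ξ ρ : ℝ) (D : Set ℝ) (k : ℝ) : ℝ :=
  2*(2*Vstar κ θ ξ ρ D k - k
    + 2*ZZ κ θ ξ ρ k * Real.sqrt (Vstar κ θ ξ ρ D k * (Vstar κ θ ξ ρ D k - k)))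

theorem quadratic_factorization {κ ξ ρ : ℝ} (hξ : 0 < ξ) (hρ₁ : -1 < ρ) (hρ₂ : ρ < 1) (u : ℝ) :
    (κ - ρ*ξ*u)^2 + u*(1-u)*ξ^2 =
      ξ^2*(1-ρ^2) * ((u - uminus κ ξ ρ) * (uplus κ ξ ρ - u)) := by
  have hρ : 0 < 1 - ρ^2 := by nlinarith
  have hη : eta κ ξ ρ ^ 2 = ξ^2*(1-ρ^2) + (2*κ - ρ*ξ)^2 := Real.sq_sqrt (by positivity)
  have hm : uminus κ ξ ρ * (2*ξ*(1-ρ^2)) = ξ - 2*κ*ρ - eta κ ξ ρ :=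
    div_mul_cancel₀ _ (by positivity)
  have hp : uplus κ ξ ρ * (2*ξ*(1-ρ^2)) = ξ - 2*κ*ρ + eta κ ξ ρ :=
    div_mul_cancel₀ _ (by positivity)
  have key : 4*(1-ρ^2) * ((κ - ρ*ξ*u)^2 + u*(1-u)*ξ^2) =
      (u * (2*ξ*(1-ρ^2)) - uminus κ ξ ρ * (2*ξ*(1-ρ^2))) *
        (uplus κ ξ ρ * (2*ξ*(1-ρ^2)) - u * (2*ξ*(1-ρ^2))) := by
    rw [hm, hp]
    linear_combination -hη
  refine mul_left_cancel₀ (by positivity : 4*(1-ρ^2) ≠ 0) (key.trans ?_)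
  ring

theorem uminus_lt_uplus {κ ξ ρ : ℝ} (hξ : 0 < ξ) (hρ₁ : -1 < ρ) (hρ₂ : ρ < 1) :
    uminus κ ξ ρ < uplus κ ξ ρ := by
  have hρ : 0 < 1 - ρ^2 := by nlinarith
  have hη : 0 < eta κ ξ ρ := Real.sqrt_pos.2 (by positivity)
  exact div_lt_div_of_pos_right (by linarith) (by positivity)

theorem stmt1 (κ θ ξ ρ : ℝ) (hκ : 0 < κ) (hθ : 0 < θ) (hξ : 0 < ξ)
    (hρ₁ : -1 < ρ) (hρ₂ : ρ < 1) :
    uminus κ ξ ρ < 0 ∧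
    1 ≤ uplus κ ξ ρ ∧
    (uplus κ ξ ρ = 1 ↔ ρ = κ/ξ) ∧
    (∀ u ∈ Set.Ioo (uminus κ ξ ρ) (uplus κ ξ ρ), 0 < (κ - ρ*ξ*u)^2 + u*(1-u)*ξ^2) ∧
    (κ - ρ*ξ*uminus κ ξ ρ)^2 + uminus κ ξ ρ*(1 - uminus κ ξ ρ)*ξ^2 = 0 ∧
    (κ - ρ*ξ*uplus κ ξ ρ)^2 + uplus κ ξ ρ*(1 - uplus κ ξ ρ)*ξ^2 = 0 := by
  have hρ : 0 < 1 - ρ^2 := by nlinarith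
  have hA : 0 < ξ^2*(1-ρ^2) := by positivity
  have hlt := uminus_lt_uplus (κ := κ) hξ hρ₁ hρ₂
  have hfac := quadratic_factorization (κ := κ) hξ hρ₁ hρ₂
  have h0 : 0 < (0 - uminus κ ξ ρ) * (uplus κ ξ ρ - 0) := by
    refine pos_of_mul_pos_right ?_ hA.le
    rw [← hfac 0]
    have := pow_pos hκ 2
    simpa using this
  have hneg : uminus κ ξ ρ < 0 := by
    by_contra! h
    nlinarith
  have h1 : (κ - ρ*ξ)^2 =
      ξ^2*(1-ρ^2) * ((1 - uminus κ ξ ρ) * (uplus κ ξ ρ - 1)) := by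
    rw [← hfac 1]
    ring
  have hB : 0 < 1 - uminus κ ξ ρ := by linarith
  refine ⟨hneg, ?_, ?_, ?_, ?_, ?_⟩
  · have h2 : 0 ≤ ξ^2*(1-ρ^2) * ((1 - uminus κ ξ ρ) * (uplus κ ξ ρ - 1)) :=
      h1 ▸ sq_nonneg (κ - ρ*ξ)
    have := nonneg_of_mul_nonneg_right (nonneg_of_mul_nonneg_right h2 hA) hB
    linarith
  · rw [eq_div_iff hξ.ne']
    constructor
    · intro h
      rw [h, sub_self, mul_zero, mul_zero] at h1
      linarith [pow_eq_zero_iff (two_ne_zero) |>.1 h1]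
    · intro h
      rw [h, sub_self, zero_pow two_ne_zero, eq_comm, mul_eq_zero_iff_left hA.ne',
        mul_eq_zero_iff_left hB.ne'] at h1
      linarith
  · rintro u ⟨hu₁, hu₂⟩
    rw [hfac u]
    exact mul_pos hA (mul_pos (sub_pos.2 hu₁) (sub_pos.2 hu₂))
  · rw [hfac]
    ring
  · rw [hfac]
    ring

end Heston
end
end

section
/- If ρ ≤ κ/ξ then V*(k) − k ≥ 0 for all k ∈ ℝ, and when ρ < κ/ξ equality holds if and only if k = V'(1). If ρ > κ/ξ (regimes R3b and R4) then V*(k) − k ≥ −V(1) > 0 for all k ∈ ℝ. -/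
open Real Set Filter Asymptotics

noncomputable section

namespace Heston

/-- The radicand of `dd`. -/
def radicand (κ ξ ρ u : ℝ) : ℝ := (κ - ρ*ξ*u)^2 + u*(1-u)*ξ^2

lemma radicand_nonneg_of_mem_Icc {κ ξ ρ a b u : ℝ} (hρ : ρ^2 < 1)
    (ha : 0 ≤ radicand κ ξ ρ a) (hb : 0 ≤ radicand κ ξ ρ b) (hau : a ≤ u) (hub : u ≤ b) :
    0 ≤ radicand κ ξ ρ u := by
  rcases hau.eq_or_lt with rfl | hau'
  · exact ha
  have key : (b - a) * radicand κ ξ ρ u = (b - u) * radicand κ ξ ρ a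
      + (u - a) * radicand κ ξ ρ b + ξ^2 * (1 - ρ^2) * ((u - a) * (b - u) * (b - a)) := by
    unfold radicand; ring
  have h1 : 0 ≤ (b - u) * radicand κ ξ ρ a := mul_nonneg (by linarith) ha
  have h2 : 0 ≤ (u - a) * radicand κ ξ ρ b := mul_nonneg (by linarith) hb
  have h3 : 0 ≤ ξ^2 * (1 - ρ^2) * ((u - a) * (b - u) * (b - a)) :=
    mul_nonneg (mul_nonneg (sq_nonneg _) (by linarith))
      (mul_nonneg (mul_nonneg (by linarith) (by linarith)) (by linarith))
  have h4 : 0 ≤ (b - a) * radicand κ ξ ρ u := by rw [key]; linarith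
  exact nonneg_of_mul_nonneg_right h4 (by linarith)

lemma eta_sq {κ ξ ρ : ℝ} (hρ : ρ^2 < 1) :
    eta κ ξ ρ ^ 2 = ξ^2*(1-ρ^2) + (2*κ - ρ*ξ)^2 := by
  unfold eta
  rw [Real.sq_sqrt]
  have : 0 ≤ ξ^2*(1-ρ^2) := mul_nonneg (sq_nonneg _) (by linarith)
  positivity

lemma radicand_uplus {κ ξ ρ : ℝ} (hξ : 0 < ξ) (hρ : ρ^2 < 1) :
    radicand κ ξ ρ (uplus κ ξ ρ) = 0 := by
  have h1 : 1 - ρ^2 ≠ 0 := by linarith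
  have hs := eta_sq (κ := κ) (ξ := ξ) hρ
  have hu : 2*ξ*(1-ρ^2) * uplus κ ξ ρ = ξ - 2*κ*ρ + eta κ ξ ρ := by
    unfold uplus; field_simp
  have he : eta κ ξ ρ = 2*ξ*(1-ρ^2) * uplus κ ξ ρ - (ξ - 2*κ*ρ) := by linarith
  rw [he] at hs
  have h0 : (4 * (1 - ρ^2)) * radicand κ ξ ρ (uplus κ ξ ρ) = 0 := by
    unfold radicand; linear_combination -hs
  exact (mul_eq_zero.mp h0).resolve_left (by positivity)

lemma radicand_uminus {κ ξ ρ : ℝ} (hξ : 0 < ξ) (hρ : ρ^2 < 1) :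
    radicand κ ξ ρ (uminus κ ξ ρ) = 0 := by
  have h1 : 1 - ρ^2 ≠ 0 := by linarith
  have hs := eta_sq (κ := κ) (ξ := ξ) hρ
  have hu : 2*ξ*(1-ρ^2) * uminus κ ξ ρ = ξ - 2*κ*ρ - eta κ ξ ρ := by
    unfold uminus; field_simp
  have he : eta κ ξ ρ = (ξ - 2*κ*ρ) - 2*ξ*(1-ρ^2) * uminus κ ξ ρ := by linarith
  rw [he] at hs
  have h0 : (4 * (1 - ρ^2)) * radicand κ ξ ρ (uminus κ ξ ρ) = 0 := by
    unfold radicand; linear_combination -hs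
  exact (mul_eq_zero.mp h0).resolve_left (by positivity)

lemma uminus_lt_one {κ ξ ρ : ℝ} (hκ : 0 < κ) (hξ : 0 < ξ) (hρ : ρ^2 < 1) :
    uminus κ ξ ρ < 1 := by
  have hs := eta_sq (κ := κ) (ξ := ξ) hρ
  have h : ξ - 2*κ*ρ < eta κ ξ ρ := by
    refine lt_of_pow_lt_pow_left₀ 2 (Real.sqrt_nonneg _) ?_
    have : 0 < κ^2 * (1 - ρ^2) := mul_pos (by positivity) (by linarith)
    rw [hs]; nlinarith
  unfold uminus
  have hp : 0 < 2*ξ*(1-ρ^2) := mul_pos (by positivity) (by linarith)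
  rw [div_lt_one hp]; linarith

lemma one_le_uplus {κ ξ ρ : ℝ} (hξ : 0 < ξ) (hρ : ρ^2 < 1) : 1 ≤ uplus κ ξ ρ := by
  have hs := eta_sq (κ := κ) (ξ := ξ) hρ
  have hp : 0 < 2*ξ*(1-ρ^2) := mul_pos (by positivity) (by linarith)
  have h : 2*ξ*(1-ρ^2) - (ξ - 2*κ*ρ) ≤ eta κ ξ ρ := by
    refine le_of_sq_le_sq ?_ (Real.sqrt_nonneg _)
    have : 0 ≤ (1 - ρ^2) * (κ - ρ*ξ)^2 := mul_nonneg (by linarith) (sq_nonneg _)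
    rw [hs]; nlinarith
  unfold uplus
  rw [one_le_div hp]; linarith

lemma one_lt_uplus {κ ξ ρ : ℝ} (hξ : 0 < ξ) (hρ : ρ^2 < 1) (hne : ρ*ξ < κ) :
    1 < uplus κ ξ ρ := by
  refine lt_of_le_of_ne (one_le_uplus hξ hρ) fun h => ?_
  have h0 := radicand_uplus (κ := κ) hξ hρ
  rw [← h] at h0
  have : 0 < (κ - ρ*ξ)^2 := pow_pos (by linarith) 2
  unfold radicand at h0
  nlinarith

/-- At a real root of the quadratic defining `ustarplus`, `ustarminus`, the radicand is a square. -/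
lemma radicand_nonneg_of_root {κ ξ ρ E p n w : ℝ} (hξ : 0 < ξ) (hE : 1 < E)
    (hp : p = ξ*(E - 1) - 4*κ*ρ*E) (hn : n^2 = p^2 - 16*κ^2*E)
    (hw : w = (p + n) / (2*ξ*(E - 1))) : 0 ≤ radicand κ ξ ρ w := by
  have hE' : E - 1 ≠ 0 := by linarith
  have hw' : n = 2*ξ*(E-1)*w - p := by rw [hw]; field_simp; ring
  rw [hw', hp] at hn
  have key : (E - 1)^2 * radicand κ ξ ρ w = ((κ - ρ*ξ*w)*(E - 1) - 2*κ*E)^2 := by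
    unfold radicand
    linear_combination (-1/4) * hn
  have h : 0 ≤ (E - 1)^2 * radicand κ ξ ρ w := by rw [key]; positivity
  exact nonneg_of_mul_nonneg_right h (pow_pos (by linarith) 2)

/-- If `ρ < rhominus`, the discriminant is positive and the larger root exceeds one. -/
lemma rhominus_bounds {A B E S p : ℝ} (hA : 0 < A) (hB : 0 < B) (hE : 1 < E) (hS : 0 < S)
    (hS2 : S^2 = B^2*E^2 + A^2) (hp : (E - 1)*A + (E + 1)*S < 2*E*p) :
    B^2*E < p^2 ∧ (p < 2*A → 4*A^2 + B^2*E < 4*A*p) := by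
  have hSA : A < S := by
    refine lt_of_pow_lt_pow_left₀ 2 hS.le ?_
    rw [hS2]; have : 0 < B^2*E^2 := by positivity
    linarith
  constructor
  · have h1 : (E + 1)*S < 2*E*p := by nlinarith
    have h2 : ((E + 1)*S)^2 < (2*E*p)^2 := by
      have : 0 < (E+1)*S := by positivity
      gcongr
    have h3 : (E+1)^2 * (B^2*E^2) ≤ ((E + 1)*S)^2 := by
      rw [mul_pow, hS2]; gcongr; nlinarith [sq_nonneg A]
    have h4 : 4*E*(B^2*E^2) ≤ (E+1)^2 * (B^2*E^2) := by
      gcongr; nlinarith [sq_nonneg (E-1)]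
    have h5 : (4*E^2)*(B^2*E) < (4*E^2)*p^2 := by nlinarith
    exact lt_of_mul_lt_mul_left h5 (by positivity)
  · intro h
    have h1 : (E + 1)*S < (3*E+1)*A := by nlinarith
    have h2 : S + A ≤ 2*(E+1)*A := by
      have : (E+1)*(S + A) ≤ (E+1)*(2*(E+1)*A) := by nlinarith [mul_pos hA (by linarith : 0 < E)]
      exact le_of_mul_le_mul_left this (by linarith)
    have h3 : (S - A)*(S + A) ≤ (S - A)*(2*(E+1)*A) :=
      mul_le_mul_of_nonneg_left h2 (by linarith)
    have h4 : 2*A*((E - 1)*A + (E + 1)*S) < 2*A*(2*E*p) := by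
      gcongr
    have h5 : E*(4*A^2 + B^2*E) < E*(4*A*p) := by nlinarith
    exact lt_of_mul_lt_mul_left h5 (by linarith)

/-- If `rhoplus < ρ`, then `psi` is negative and the discriminant is positive. -/
lemma rhoplus_bounds {A B E S p : ℝ} (hB : 0 < B) (hE : 1 < E) (hS : 0 < S)
    (hS2 : S^2 = B^2*E^2 + A^2) (hp : 2*E*p < (E - 1)*A - (E + 1)*S) :
    p < 0 ∧ B^2*E < p^2 := by
  set R := Real.sqrt E with hR
  have hR2 : R^2 = E := Real.sq_sqrt (by linarith)
  have hR0 : 0 < R := Real.sqrt_pos.mpr (by linarith)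
  have hc : (E - 1)*A + 2*R*(E*B) ≤ (E + 1)*S := by
    refine le_of_sq_le_sq ?_ (by positivity)
    have : ((E + 1)*S)^2 - ((E - 1)*A + 2*R*(E*B))^2
        = (2*R*A - (E-1)*(E*B))^2 := by
      rw [mul_pow, hS2]
      linear_combination (-4*A^2 - 4*E^2*B^2) * hR2
    nlinarith [sq_nonneg (2*R*A - (E-1)*(E*B))]
  have h1 : 2*E*(R*B) < 2*E*(-p) := by linarith
  have h2 : R*B < -p := lt_of_mul_lt_mul_left h1 (by linarith)
  have h3 : 0 < R*B := by positivity
  refine ⟨by linarith, ?_⟩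
  have : (R*B)^2 < (-p)^2 := by gcongr
  rw [mul_pow, hR2] at this
  linarith

lemma ustarplus_bounds {κ ξ ρ t : ℝ} (hκ : 0 < κ) (hξ : 0 < ξ) (ht : 0 < t)
    (h : ρ < rhominus κ ξ t) :
    1 < ustarplus κ ξ ρ t ∧ 0 ≤ radicand κ ξ ρ (ustarplus κ ξ ρ t) := by
  have hE : 1 < Real.exp (κ*t) := Real.one_lt_exp_iff.mpr (by positivity)
  have e2 : Real.exp (2*κ*t) = Real.exp (κ*t) ^ 2 := by
    rw [← Real.exp_nat_mul]; congr 1; push_cast; ring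
  unfold rhominus at h
  rw [Real.exp_neg, e2] at h
  unfold ustarplus nuu
  have hpd : psi κ ξ ρ t = ξ*(Real.exp (κ*t) - 1) - 4*κ*ρ*Real.exp (κ*t) := rfl
  generalize psi κ ξ ρ t = p at *
  generalize Real.exp (κ*t) = E at *
  have hE1 : 0 < E - 1 := by linarith
  have hpos : 0 < 16*κ^2*E^2 + ξ^2*(1-E)^2 := by positivity
  have hS := Real.sqrt_pos.mpr hpos
  have hS2 := Real.sq_sqrt hpos.le
  generalize Real.sqrt (16*κ^2*E^2 + ξ^2*(1-E)^2) = S at *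
  have hp : (E - 1)*(ξ*(E-1)) + (E + 1)*S < 2*E*p := by
    have h' : ρ < (ξ*(E^2-1) - (E+1)*S) / (E^2*(8*κ)) := by
      convert h using 1; field_simp
    rw [lt_div_iff₀ (by positivity)] at h'
    rw [hpd]; nlinarith
  obtain ⟨h1, h2⟩ := rhominus_bounds (A := ξ*(E-1)) (B := 4*κ) (by positivity) (by positivity)
    hE hS (by rw [hS2]; ring) hp
  have hd : 0 < p^2 - 16*κ^2*E := by linarith
  have hn2 := Real.sq_sqrt hd.le
  have hn0 := Real.sqrt_pos.mpr hd
  refine ⟨?_, radicand_nonneg_of_root hξ hE hpd hn2 rfl⟩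
  rw [one_lt_div (by positivity)]
  rcases lt_or_ge p (2*(ξ*(E-1))) with hlt | hge
  · have h3 := h2 hlt
    have : 2*(ξ*(E-1)) - p < Real.sqrt (p^2 - 16*κ^2*E) := by
      refine lt_of_pow_lt_pow_left₀ 2 hn0.le ?_
      rw [hn2]; linarith
    linarith
  · linarith

lemma ustarminus_bounds {κ ξ ρ t : ℝ} (hκ : 0 < κ) (hξ : 0 < ξ) (ht : 0 < t)
    (h : rhoplus κ ξ t < ρ) :
    ustarminus κ ξ ρ t < 1 ∧ 0 ≤ radicand κ ξ ρ (ustarminus κ ξ ρ t) := by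
  have hE : 1 < Real.exp (κ*t) := Real.one_lt_exp_iff.mpr (by positivity)
  have hn := Real.sqrt_nonneg ((psi κ ξ ρ t)^2 - 16*κ^2*Real.exp (κ*t))
  have e2 : Real.exp (2*κ*t) = Real.exp (κ*t) ^ 2 := by
    rw [← Real.exp_nat_mul]; congr 1; push_cast; ring
  unfold rhoplus at h
  rw [Real.exp_neg, e2] at h
  unfold ustarminus nuu
  have hpd : psi κ ξ ρ t = ξ*(Real.exp (κ*t) - 1) - 4*κ*ρ*Real.exp (κ*t) := rfl
  generalize psi κ ξ ρ t = p at *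
  generalize Real.exp (κ*t) = E at *
  have hE1 : 0 < E - 1 := by linarith
  have hpos : 0 < 16*κ^2*E^2 + ξ^2*(1-E)^2 := by positivity
  have hS := Real.sqrt_pos.mpr hpos
  have hS2 := Real.sq_sqrt hpos.le
  generalize Real.sqrt (16*κ^2*E^2 + ξ^2*(1-E)^2) = S at *
  have hp : 2*E*p < (E - 1)*(ξ*(E-1)) - (E + 1)*S := by
    have h' : (ξ*(E^2-1) + (E+1)*S) / (E^2*(8*κ)) < ρ := by
      convert h using 1; field_simp
    rw [div_lt_iff₀ (by positivity)] at h'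
    rw [hpd]; nlinarith
  obtain ⟨h1, h2⟩ := rhoplus_bounds (A := ξ*(E-1)) (B := 4*κ) (by positivity) hE
    hS (by rw [hS2]; ring) hp
  have hd : 0 < p^2 - 16*κ^2*E := by linarith
  have hn2 := Real.sq_sqrt hd.le
  refine ⟨?_, radicand_nonneg_of_root hξ hE hpd (n := -Real.sqrt (p^2 - 16*κ^2*E))
    (by rw [neg_sq, hn2]) (by rw [sub_eq_add_neg])⟩
  have : 0 < 2*ξ*(E-1) := by positivity
  rw [div_lt_one this]
  linarith

lemma rho_sq_lt_one {ρ : ℝ} (hρ₁ : -1 < ρ) (hρ₂ : ρ < 1) : ρ^2 < 1 := by nlinarith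

lemma one_mem_domain {κ ξ ρ t : ℝ} (hκ : 0 < κ) (hξ : 0 < ξ) (hρ : ρ^2 < 1) (ht : 0 < t)
    {D : Set ℝ} (hD : regimeD κ ξ ρ t D) : 1 ∈ D := by
  have hm := uminus_lt_one hκ hξ hρ
  have hp := one_le_uplus (κ := κ) hξ hρ
  rcases hD with ⟨h, rfl⟩ | ⟨h, rfl⟩ | ⟨h, rfl⟩ | ⟨h, rfl⟩ | ⟨h, rfl⟩
  · exact ⟨hm.le, hp⟩
  · exact ⟨hm.le, (ustarplus_bounds hκ hξ ht h.2).1⟩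
  · exact ⟨(ustarminus_bounds hκ hξ ht h.1).1, hp⟩
  · exact ⟨(ustarminus_bounds hκ hξ ht h.1).1, le_rfl⟩
  · exact ⟨hm, le_rfl⟩

lemma exists_domain_subset_Icc {κ ξ ρ t : ℝ} {D : Set ℝ} (hD : regimeD κ ξ ρ t D) :
    ∃ a b, D ⊆ Set.Icc a b := by
  rcases hD with ⟨-, rfl⟩ | ⟨-, rfl⟩ | ⟨-, rfl⟩ | ⟨-, rfl⟩ | ⟨-, rfl⟩
  · exact ⟨_, _, subset_rfl⟩
  · exact ⟨_, _, Set.Ico_subset_Icc_self⟩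
  all_goals exact ⟨_, _, Set.Ioc_subset_Icc_self⟩

lemma domain_mem_nhds_one {κ ξ ρ t : ℝ} (hκ : 0 < κ) (hξ : 0 < ξ) (hρ : ρ^2 < 1) (ht : 0 < t)
    (hlt : ρ < κ/ξ) {D : Set ℝ} (hD : regimeD κ ξ ρ t D) : D ∈ nhds (1 : ℝ) := by
  have hm := uminus_lt_one hκ hξ hρ
  have hp := one_lt_uplus hξ hρ ((lt_div_iff₀ hξ).mp hlt)
  rcases hD with ⟨h, rfl⟩ | ⟨h, rfl⟩ | ⟨h, rfl⟩ | ⟨h, rfl⟩ | ⟨h, rfl⟩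
  · exact Icc_mem_nhds hm hp
  · exact Ico_mem_nhds hm (ustarplus_bounds hκ hξ ht h.2).1
  · exact Ioc_mem_nhds (ustarminus_bounds hκ hξ ht h.1).1 hp
  · exact absurd h.2.2 hlt.not_gt
  · exact absurd h.1 hlt.not_gt

lemma radicand_nonneg_of_mem_domain {κ ξ ρ t : ℝ} (hκ : 0 < κ) (hξ : 0 < ξ) (hρ : ρ^2 < 1)
    (ht : 0 < t) {D : Set ℝ} (hD : regimeD κ ξ ρ t D) {u : ℝ} (hu : u ∈ D) :
    0 ≤ radicand κ ξ ρ u := by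
  have hm := (radicand_uminus (κ := κ) hξ hρ).ge
  have hp := (radicand_uplus (κ := κ) hξ hρ).ge
  have h1 : 0 ≤ radicand κ ξ ρ 1 := by
    have := sq_nonneg (κ - ρ*ξ)
    unfold radicand; nlinarith
  rcases hD with ⟨h, rfl⟩ | ⟨h, rfl⟩ | ⟨h, rfl⟩ | ⟨h, rfl⟩ | ⟨h, rfl⟩
  · exact radicand_nonneg_of_mem_Icc hρ hm hp hu.1 hu.2
  · exact radicand_nonneg_of_mem_Icc hρ hm (ustarplus_bounds hκ hξ ht h.2).2 hu.1 hu.2.le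
  · exact radicand_nonneg_of_mem_Icc hρ (ustarminus_bounds hκ hξ ht h.1).2 hp hu.1.le hu.2
  · exact radicand_nonneg_of_mem_Icc hρ (ustarminus_bounds hκ hξ ht h.1).2 h1 hu.1.le hu.2
  · exact radicand_nonneg_of_mem_Icc hρ hm h1 hu.1.le hu.2

lemma continuous_VV (κ θ ξ ρ : ℝ) : Continuous (VV κ θ ξ ρ) := by
  unfold VV dd; fun_prop

lemma bddAbove_image {κ θ ξ ρ t : ℝ} {D : Set ℝ} (hD : regimeD κ ξ ρ t D) (k : ℝ) :
    BddAbove ((fun u => u*k - VV κ θ ξ ρ u) '' D) := by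
  obtain ⟨a, b, hab⟩ := exists_domain_subset_Icc hD
  have hc : Continuous fun u => u*k - VV κ θ ξ ρ u := by
    have := continuous_VV κ θ ξ ρ
    fun_prop
  exact (isCompact_Icc.bddAbove_image hc.continuousOn).mono (Set.image_mono hab)

lemma VV_one (κ θ ξ ρ : ℝ) :
    VV κ θ ξ ρ 1 = mu κ θ ξ / 2 * (κ - ρ*ξ - |κ - ρ*ξ|) := by
  unfold VV dd
  rw [← Real.sqrt_sq_eq_abs]
  ring_nf

lemma hasDerivAt_VV_one (θ : ℝ) {κ ξ ρ : ℝ} (h : ρ*ξ < κ) :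
    HasDerivAt (VV κ θ ξ ρ) (mu κ θ ξ / 2 * (ξ^2 / (2*(κ - ρ*ξ)))) 1 := by
  have ha : 0 < κ - ρ*ξ := by linarith
  have hlin : HasDerivAt (fun u : ℝ => κ - ρ*ξ*u) (-(ρ*ξ)) 1 := by
    simpa using ((hasDerivAt_id (1:ℝ)).const_mul (ρ*ξ)).const_sub κ
  have hq : HasDerivAt (fun u : ℝ => (κ - ρ*ξ*u)^2 + u*(1-u)*ξ^2)
      (2*(κ - ρ*ξ)*(-(ρ*ξ)) - ξ^2) 1 := by
    have h2 := ((hasDerivAt_id (1:ℝ)).mul ((hasDerivAt_id (1:ℝ)).const_sub 1)).mul_const (ξ^2)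
    refine ((hlin.pow 2).add h2).congr_deriv ?_
    norm_num
    ring
  have hr : (κ - ρ*ξ*1)^2 + 1*(1-1)*ξ^2 = (κ - ρ*ξ)^2 := by ring
  have hs := hq.sqrt (by rw [hr]; positivity)
  rw [hr, Real.sqrt_sq ha.le] at hs
  refine ((hlin.sub hs).const_mul (mu κ θ ξ / 2)).congr_deriv ?_
  field_simp
  ring

/-- The tangent line to `VV` at `1` lies below `VV` wherever the radicand is nonnegative. -/
lemma tangent_le_VV {κ θ ξ ρ u : ℝ} (hκ : 0 < κ) (hθ : 0 < θ) (hξ : 0 < ξ) (hρ : ρ^2 < 1)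
    (h : ρ*ξ < κ) (hu : 0 ≤ radicand κ ξ ρ u) :
    mu κ θ ξ / 2 * (ξ^2 / (2*(κ - ρ*ξ))) * (u - 1) ≤ VV κ θ ξ ρ u := by
  have ha : 0 < κ - ρ*ξ := by linarith
  obtain ⟨a, hadef⟩ : ∃ a, a = κ - ρ*ξ := ⟨_, rfl⟩
  rw [← hadef] at ha ⊢
  have hmu : 0 < mu κ θ ξ / 2 := by unfold mu; positivity
  obtain ⟨L, hL⟩ : ∃ L : ℝ → ℝ, L = fun w => κ - ρ*ξ*w - ξ^2/(2*a)*(w-1) := ⟨_, rfl⟩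
  have hc : 0 < a^2 + ρ*ξ*a + ξ^2/4 := by
    have h1 : 0 < a^2*(1 - ρ^2) := mul_pos (by positivity) (by linarith)
    nlinarith [sq_nonneg (ρ*a + ξ/2)]
  have key : ∀ w, L w ^ 2 = radicand κ ξ ρ w + (ξ*(w-1)/a)^2 * (a^2 + ρ*ξ*a + ξ^2/4) := by
    intro w
    have hκ' : κ = a + ρ*ξ := by linarith
    rw [hL, hκ']; unfold radicand; field_simp; ring
  have hL1 : L 1 = a := by rw [hL, hadef]; ring
  have hLu : 0 ≤ L u := by
    by_contra! hneg
    obtain ⟨r, hr⟩ : ∃ r, r = a / (a - L u) := ⟨_, rfl⟩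
    have hd : 0 < a - L u := by linarith
    have hr0 : 0 < r := by rw [hr]; positivity
    have hr1 : r < 1 := by rw [hr, div_lt_one hd]; linarith
    have hLw : L (1 + r*(u-1)) = 0 := by
      have : L (1 + r*(u-1)) = L 1 + r*(L u - L 1) := by rw [hL]; ring
      rw [this, hL1, hr]; field_simp; ring
    have hne : u ≠ 1 := by rintro rfl; linarith
    have h1 : 0 ≤ radicand κ ξ ρ 1 := by
      have := sq_nonneg (κ - ρ*ξ)
      unfold radicand; nlinarith
    have hw : 0 ≤ radicand κ ξ ρ (1 + r*(u-1)) := by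
      rcases lt_or_gt_of_ne hne with hlt | hgt
      · exact radicand_nonneg_of_mem_Icc hρ hu h1 (by nlinarith) (by nlinarith)
      · exact radicand_nonneg_of_mem_Icc hρ h1 hu (by nlinarith) (by nlinarith)
    have hk := key (1 + r*(u-1))
    rw [hLw] at hk
    have hx : ξ*(1 + r*(u-1) - 1)/a ≠ 0 := by
      have : u - 1 ≠ 0 := sub_ne_zero.mpr hne
      rw [add_sub_cancel_left]; positivity
    have : 0 < (ξ*(1 + r*(u-1) - 1)/a)^2 * (a^2 + ρ*ξ*a + ξ^2/4) := by positivity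
    linarith
  have hdd : dd κ ξ ρ u ≤ L u := by
    refine Real.sqrt_le_iff.mpr ⟨hLu, ?_⟩
    rw [key u]
    exact le_add_of_nonneg_right (by positivity)
  unfold VV
  rw [mul_assoc]
  refine mul_le_mul_of_nonneg_left ?_ hmu.le
  rw [hL] at hdd
  simp only at hdd
  linarith

theorem stmt5 (κ θ ξ ρ v t : ℝ) (hκ : 0 < κ) (hθ : 0 < θ) (hξ : 0 < ξ) (hv : 0 < v)
    (hρ₁ : -1 < ρ) (hρ₂ : ρ < 1) (ht : 0 < t)
    (D : Set ℝ) (hD : regimeD κ ξ ρ t D) :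
    (ρ ≤ κ/ξ → ∀ k : ℝ,
      0 ≤ Vstar κ θ ξ ρ D k - k ∧
      (ρ < κ/ξ → (Vstar κ θ ξ ρ D k - k = 0 ↔ k = deriv (VV κ θ ξ ρ) 1))) ∧
    (κ/ξ < ρ →
      0 < -VV κ θ ξ ρ 1 ∧ ∀ k : ℝ, -VV κ θ ξ ρ 1 ≤ Vstar κ θ ξ ρ D k - k) := by
  have hρ := rho_sq_lt_one hρ₁ hρ₂
  have h1 := one_mem_domain hκ hξ hρ ht hD
  have hmu : 0 < mu κ θ ξ := by unfold mu; positivity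
  have hge : ∀ k : ℝ, ∀ u ∈ D, u*k - VV κ θ ξ ρ u ≤ Vstar κ θ ξ ρ D k := fun k u hu =>
    le_csSup (bddAbove_image hD k) (Set.mem_image_of_mem _ hu)
  constructor
  · intro hle k
    have hV1 : VV κ θ ξ ρ 1 = 0 := by
      rw [VV_one, abs_of_nonneg (by linarith [(le_div_iff₀ hξ).mp hle]), sub_self, mul_zero]
    have hk := hge k 1 h1
    refine ⟨by linarith, fun hlt => ?_⟩
    have hlt' := (lt_div_iff₀ hξ).mp hlt
    have hder := hasDerivAt_VV_one θ hlt'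
    rw [hder.deriv]
    constructor
    · intro heq
      have hmax : IsLocalMax (fun u => u*k - VV κ θ ξ ρ u) 1 := by
        filter_upwards [domain_mem_nhds_one hκ hξ hρ ht hlt hD] with u hu
        have := hge k u hu
        linarith
      have h0 := hmax.hasDerivAt_eq_zero (((hasDerivAt_id (1:ℝ)).mul_const k).sub hder)
      linarith
    · intro heq
      have : Vstar κ θ ξ ρ D k ≤ k := by
        refine csSup_le (Set.Nonempty.image _ ⟨1, h1⟩) ?_
        rintro _ ⟨u, hu, rfl⟩
        have := tangent_le_VV hκ hθ hξ hρ hlt'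
          (radicand_nonneg_of_mem_domain hκ hξ hρ ht hD hu)
        rw [← heq] at this
        simp only
        linarith
      linarith
  · intro hlt
    have hlt' := (div_lt_iff₀ hξ).mp hlt
    refine ⟨?_, fun k => by linarith [hge k 1 h1]⟩
    rw [VV_one, abs_of_neg (by linarith)]
    nlinarith

end Heston
end
end

section
/- Assume regime R2 and let k > V'(u*_+). Define ζ²_+(k) := 4β_t·(V'(u*_+)(k−V'(u*_+))³/(κθv e^{−κt}))^{1/2}, a₁⁺(k) := −2(k−V'(u*_+))/ζ²_+(k), and a₂⁺(k) := (μ e^{−κt}/(16β_t²))·(ξ²v V''(u*_+) − 8β_t² e^{κt} V'(u*_+)(k−V'(u*_+)))/(V'(u*_+)(k−V'(u*_+))²). If (u*_τ(k))_{τ>τ₁} solves V'(u*_τ(k)) + H'(u*_τ(k))/τ = k with u*_τ(k) in the interior of D∞ and u*_τ(k) → u*_+, then u*_τ(k) = u*_+ + a₁⁺(k)·τ^{−1/2} + a₂⁺(k)·τ^{−1} + O(τ^{−3/2}) as τ → ∞. -/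
open Real Set Filter Asymptotics

noncomputable section

namespace Heston

/-- The slope of an analytic function based at a point of analyticity is analytic there. -/
lemma analyticAt_dslope_self {f : ℝ → ℝ} {w : ℝ} (hf : AnalyticAt ℝ f w) :
    AnalyticAt ℝ (dslope f w) w := by
  obtain ⟨p, hp⟩ := hf
  exact ⟨_, hp.has_fpower_series_dslope_fslope⟩

lemma eq_add_mul_dslope (f : ℝ → ℝ) (w u : ℝ) : f u = f w + (u - w) * dslope f w u := by
  have h := sub_smul_dslope f w u
  rw [smul_eq_mul] at h
  linarith

lemma deriv_deriv_eq_two_mul_deriv_dslope {f : ℝ → ℝ} {w : ℝ} (hf : AnalyticAt ℝ f w) :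
    deriv (deriv f) w = 2 * deriv (dslope f w) w := by
  have hS := analyticAt_dslope_self hf
  have hd : deriv f =ᶠ[nhds w]
      fun u => dslope f w u + (u - w) * deriv (dslope f w) u := by
    filter_upwards [hS.eventually_analyticAt] with u hu
    have h1 : HasDerivAt (fun u => f w + (u - w) * dslope f w u)
        (1 * dslope f w u + (u - w) * deriv (dslope f w) u) u :=
      (((hasDerivAt_id u).sub_const w).mul hu.differentiableAt.hasDerivAt).const_add (f w)
    rw [← funext (eq_add_mul_dslope f w)] at h1
    rw [h1.deriv, one_mul]
  rw [hd.deriv_eq]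
  have h2 : HasDerivAt (fun u => dslope f w u + (u - w) * deriv (dslope f w) u)
      (deriv (dslope f w) w + (1 * deriv (dslope f w) w
        + (w - w) * deriv (deriv (dslope f w)) w)) w :=
    hS.differentiableAt.hasDerivAt.add
      (((hasDerivAt_id w).sub_const w).mul hS.deriv.differentiableAt.hasDerivAt)
  rw [h2.deriv]
  ring

/-- First-order Taylor expansion of an analytic function with quadratic remainder. -/
lemma isBigO_sub_linear {f : ℝ → ℝ} {w : ℝ} (hf : AnalyticAt ℝ f w) :
    (fun u => f u - f w - deriv f w * (u - w)) =O[nhds w] fun u => (u - w) ^ 2 := by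
  have h := ((analyticAt_dslope_self hf).differentiableAt.isBigO_sub).mul
    (isBigO_refl (fun u => u - w) (nhds w))
  refine h.congr (fun u => ?_) (fun u => by ring)
  rw [dslope_same, eq_add_mul_dslope f w u]
  ring

/-- If `τ (w - u τ)² = G (u τ)` with `G` analytic at `w`, `G w > 0` and `u τ ↑ w`, then `u` has
an expansion in powers of `τ ^ (-1/2)`. -/
lemma isBigO_of_mul_sq_eq {G u : ℝ → ℝ} {w : ℝ} (hG : AnalyticAt ℝ G w) (hpos : 0 < G w)
    (hu : Tendsto u atTop (nhds w)) (hlt : ∀ᶠ τ in atTop, u τ < w)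
    (heq : ∀ᶠ τ in atTop, τ * (w - u τ) ^ 2 = G (u τ)) :
    (fun τ : ℝ => u τ - (w - √(G w) * τ ^ (-(1:ℝ)/2) + deriv G w / 2 * τ ^ (-(1:ℝ))))
      =O[atTop] fun τ : ℝ => τ ^ (-(3:ℝ)/2) := by
  set r := √(G w) with hr
  set g := deriv G w with hg
  have hr0 : 0 < r := Real.sqrt_pos.2 hpos
  have hr2 : r ^ 2 = G w := Real.sq_sqrt hpos.le
  obtain ⟨C, hC0, hC⟩ := ((isBigO_sub_linear hG).comp_tendsto hu).exists_pos
  have hGb : ∀ᶠ τ in atTop, G (u τ) < G w + 1 :=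
    (hG.continuousAt.tendsto.comp hu).eventually_lt_const (by linarith)
  have hs : Tendsto (fun τ : ℝ => τ ^ (-((1:ℝ)/2))) atTop (nhds 0) :=
    tendsto_rpow_neg_atTop (by norm_num)
  have hss : ∀ᶠ τ : ℝ in atTop, (|g| + 1) * τ ^ (-((1:ℝ)/2)) < r := by
    have h := hs.const_mul (|g| + 1)
    rw [mul_zero] at h
    exact h.eventually_lt_const hr0
  refine IsBigO.of_bound ((C * (G w + 1) + g ^ 2 / 4) * (2 / r)) ?_
  filter_upwards [hC.bound, hGb, hss, hlt, heq, eventually_gt_atTop 0] with τ h1 h2 h3 h4 h5 h6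
  set s := τ ^ (-(1:ℝ)/2) with hsdef
  have hs0 : 0 < s := Real.rpow_pos_of_pos h6 _
  have hs2 : τ ^ (-(1:ℝ)) = s ^ 2 := by
    rw [hsdef, ← Real.rpow_natCast, ← Real.rpow_mul h6.le]; norm_num
  have hs3 : τ ^ (-(3:ℝ)/2) = s ^ 3 := by
    rw [hsdef, ← Real.rpow_natCast, ← Real.rpow_mul h6.le]; norm_num
  have hτ : τ * s ^ 2 = 1 := by
    rw [← hs2, Real.rpow_neg_one, mul_inv_cancel₀ h6.ne']
  have h3' : (|g| + 1) * s < r := by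
    rw [hsdef, neg_div]; exact h3
  rw [hs2, hs3, Real.norm_of_nonneg (by positivity : (0:ℝ) ≤ s ^ 3), Real.norm_eq_abs]
  obtain ⟨y, hy⟩ : ∃ y, w - u τ = s * y := ⟨(w - u τ) / s, by field_simp⟩
  have hy0 : 0 < y := pos_of_mul_pos_right (by linarith : 0 < s * y) hs0.le
  have hy2 : y ^ 2 = G (u τ) := by
    rw [← h5, hy]; linear_combination (-y ^ 2) * hτ
  have huw : u τ - w = -(s * y) := by linarith
  simp only [Function.comp_apply, Real.norm_eq_abs, huw, ← hy2, ← hr2] at h1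
  rw [abs_of_nonneg (sq_nonneg (-(s * y)))] at h1
  have hbd : |(y + g * s / 2) ^ 2 - r ^ 2| ≤ (C * (G w + 1) + g ^ 2 / 4) * s ^ 2 := by
    have hCy : C * (-(s * y)) ^ 2 ≤ C * (G w + 1) * s ^ 2 := by
      have : y ^ 2 ≤ G w + 1 := by linarith
      have := mul_le_mul_of_nonneg_left this (by positivity : 0 ≤ C * s ^ 2)
      linarith
    rw [abs_le] at h1 ⊢
    constructor <;> nlinarith [sq_nonneg (g * s)]
  have hden : r / 2 ≤ y + g * s / 2 + r := by
    have : -(|g| * s) ≤ g * s := by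
      have := mul_le_mul_of_nonneg_right (neg_abs_le g) hs0.le
      linarith
    nlinarith
  have hfac : |y + g * s / 2 - r| * (r / 2) ≤ |(y + g * s / 2) ^ 2 - r ^ 2| := by
    have : (y + g * s / 2) ^ 2 - r ^ 2 = (y + g * s / 2 - r) * (y + g * s / 2 + r) := by ring
    rw [this, abs_mul, abs_of_pos (by linarith : 0 < y + g * s / 2 + r)]
    exact mul_le_mul_of_nonneg_left hden (abs_nonneg _)
  have hfin : |y + g * s / 2 - r| ≤ (C * (G w + 1) + g ^ 2 / 4) * (2 / r) * s ^ 2 := by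
    have h := (le_div_iff₀ (by positivity : 0 < r / 2)).2 (hfac.trans hbd)
    refine h.trans (le_of_eq ?_)
    field_simp
  have hexpr : u τ - (w - r * s + g / 2 * s ^ 2) = -(s * (y + g * s / 2 - r)) := by
    linear_combination huw
  rw [hexpr, abs_neg, abs_mul, abs_of_pos hs0]
  calc s * |y + g * s / 2 - r|
      ≤ s * ((C * (G w + 1) + g ^ 2 / 4) * (2 / r) * s ^ 2) :=
        mul_le_mul_of_nonneg_left hfin hs0.le
    _ = _ := by ring

/-- Explicit facts about the upper endpoint of the limiting domain when `ρ < ρ₋`. -/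
lemma ustarplus_spec {κ ξ ρ t : ℝ} (hκ : 0 < κ) (hξ : 0 < ξ) (ht : 0 < t)
    (hρ : ρ < rhominus κ ξ t) :
    0 < dd κ ξ ρ (ustarplus κ ξ ρ t) ∧
    κ - ρ*ξ*ustarplus κ ξ ρ t - dd κ ξ ρ (ustarplus κ ξ ρ t)
      = 2*κ*Real.exp (κ*t) / (Real.exp (κ*t) - 1) ∧
    -(4*κ*ρ*Real.exp (κ*t)) < (2*ustarplus κ ξ ρ t - 1) * (ξ*(Real.exp (κ*t) - 1)) := by
  set E := Real.exp (κ*t) with hE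
  have hE1 : 1 < E := Real.one_lt_exp_iff.2 (by positivity)
  have hE0 : 0 < E := by linarith
  set w := ustarplus κ ξ ρ t with hw
  obtain ⟨a, ha⟩ : ∃ a, a = ξ*(E - 1) := ⟨_, rfl⟩
  obtain ⟨b, hb⟩ : ∃ b, b = -(4*κ*ρ*E) := ⟨_, rfl⟩
  have ha0 : 0 < a := by rw [ha]; exact mul_pos hξ (by linarith)
  have hE2 : Real.exp (2*κ*t) = E ^ 2 := by
    rw [hE, ← Real.exp_nat_mul]; congr 1; push_cast; ring
  obtain ⟨q, hq⟩ : ∃ q, q = Real.sqrt (16*κ^2*E^2 + a^2) := ⟨_, rfl⟩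
  have hq0 : 0 ≤ q := by rw [hq]; exact Real.sqrt_nonneg _
  have hq2 : q ^ 2 = 16*κ^2*E^2 + a^2 := by rw [hq]; exact Real.sq_sqrt (by positivity)
  have hR : q * (E + 1) < a * (E + 1) + 2 * b * E := by
    have h : rhominus κ ξ t = (E + 1) * (a - q) / (8 * κ * E ^ 2) := by
      have hqa : ξ^2*(1 - E)^2 = a ^ 2 := by rw [ha]; ring
      rw [rhominus, Real.exp_neg, hE2, ← hE, hqa, ← hq, ha]
      field_simp
      ring
    rw [h, lt_div_iff₀ (by positivity)] at hρ
    rw [hb]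
    nlinarith
  have hqa : a < q := by
    have : a ^ 2 < q ^ 2 := by rw [hq2]; have : 0 < 16*κ^2*E^2 := by positivity
                               linarith
    exact lt_of_pow_lt_pow_left₀ 2 hq0 this
  have hb0 : 0 < b := by
    have : a * (E + 1) < q * (E + 1) := mul_lt_mul_of_pos_right hqa (by linarith)
    have : 0 < b * (2 * E) := by linarith
    exact pos_of_mul_pos_left this (by positivity)
  have hmain : 4*κ^2*E*(E+1)^2 < a*b*(E+1) + b^2*E := by
    have h := pow_lt_pow_left₀ hR (by positivity) two_ne_zero
    have h' : 4 * E * (4*κ^2*E*(E+1)^2) < 4 * E * (a*b*(E+1) + b^2*E) := by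
      have e1 : (q * (E + 1)) ^ 2 = (16*κ^2*E^2 + a^2) * (E+1)^2 := by rw [← hq2]; ring
      rw [e1] at h
      linarith
    exact lt_of_mul_lt_mul_left h' (by positivity)
  have hdisc : 0 < (a + b)^2 - 16*κ^2*E := by
    have h1 : 0 < E * a ^ 2 + a * b * (E - 1) + 4*κ^2*E*(E-1)^2 := by
      have : 0 < E - 1 := by linarith
      positivity
    have : 0 < E * ((a + b)^2 - 16*κ^2*E) := by linarith
    exact pos_of_mul_pos_right this hE0.le
  obtain ⟨n, hn⟩ : ∃ n, n = nuu κ ξ ρ t := ⟨_, rfl⟩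
  have hpsi : psi κ ξ ρ t = a + b := by rw [psi, ← hE, ha, hb]; ring
  have hn' : n = Real.sqrt ((a + b)^2 - 16*κ^2*E) := by rw [hn, nuu, hpsi]
  have hn0 : 0 < n := by rw [hn']; exact Real.sqrt_pos.2 hdisc
  have hn2 : n ^ 2 = (a + b)^2 - 16*κ^2*E := by rw [hn']; exact Real.sq_sqrt hdisc.le
  have hwa : 2 * a * w = a + b + n := by
    rw [hw, ustarplus, hpsi, ← hn, mul_assoc 2 ξ, ← hE, ← ha]
    field_simp
  have hquad : a^2*w*(w-1) = a*b*w - 4*κ^2*E := by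
    have : (2*a*w - (a+b))^2 = (a + b)^2 - 16*κ^2*E := by rw [hwa, ← hn2]; ring
    linarith
  have hA : 8*κ^2*E*(E+1) < b * (a + b + n) := by
    by_contra! h
    have h1 : b * n ≤ 8*κ^2*E*(E+1) - b * (a + b) := by linarith
    have h2 := pow_le_pow_left₀ (by positivity) h1 2
    rw [mul_pow, hn2] at h2
    have h3 : 16*κ^2*E * (a*b*(E+1) + b^2*E) ≤ 16*κ^2*E * (4*κ^2*E*(E+1)^2) := by linarith
    exact absurd (le_of_mul_le_mul_left h3 (by positivity)) (not_le.2 hmain)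
  have hEm : 0 < E - 1 := by linarith
  have hρb : ρ = -b / (4*κ*E) := by rw [hb]; field_simp
  have hξa : ξ = a / (E - 1) := by rw [ha]; field_simp
  have hAw : κ - ρ*ξ*w - 2*κ*E/(E-1) = (a*b*w - 4*κ^2*E*(E+1)) / (4*κ*E*(E-1)) := by
    rw [hρb, hξa]; field_simp; ring
  have hpos : 0 < κ - ρ*ξ*w - 2*κ*E/(E-1) := by
    rw [hAw]
    refine div_pos ?_ (by positivity)
    have : b * (2 * a * w) = b * (a + b + n) := by rw [hwa]
    linarith
  have hd : dd κ ξ ρ w = κ - ρ*ξ*w - 2*κ*E/(E-1) := by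
    rw [dd, ← Real.sqrt_sq hpos.le]
    congr 1
    have h1 : w*(1-w)*ξ^2 = -(a*b*w - 4*κ^2*E) / (E-1)^2 := by
      rw [← hquad, hξa]; field_simp; ring
    rw [h1, hρb, hξa]
    field_simp
    ring
  refine ⟨hd ▸ hpos, by rw [hd]; ring, ?_⟩
  rw [← ha, ← hb]
  linarith

lemma analyticAt_dd {κ ξ ρ u : ℝ} (h : 0 < dd κ ξ ρ u) : AnalyticAt ℝ (dd κ ξ ρ) u := by
  refine ContDiffAt.analyticAt (ContDiffAt.sqrt ?_ (Real.sqrt_pos.1 h).ne')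
  exact ContDiff.contDiffAt (by fun_prop)

lemma analyticAt_VV {κ θ ξ ρ u : ℝ} (h : 0 < dd κ ξ ρ u) : AnalyticAt ℝ (VV κ θ ξ ρ) u := by
  have := analyticAt_dd h
  unfold VV
  fun_prop

lemma analyticAt_gam {κ ξ ρ u : ℝ} (h : 0 < dd κ ξ ρ u) (h' : κ - ρ*ξ*u + dd κ ξ ρ u ≠ 0) :
    AnalyticAt ℝ (gam κ ξ ρ) u := by
  have := analyticAt_dd h
  unfold gam
  exact AnalyticAt.div (by fun_prop) (by fun_prop) h'

lemma deriv_VV {κ θ ξ ρ u : ℝ} (h : 0 < dd κ ξ ρ u) :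
    deriv (VV κ θ ξ ρ) u = mu κ θ ξ / 2 *
      (-(ρ*ξ) - (-(2*ρ*ξ*(κ - ρ*ξ*u)) + (1 - 2*u)*ξ^2) / (2 * dd κ ξ ρ u)) := by
  have hl : HasDerivAt (fun u => κ - ρ*ξ*u) (-(ρ*ξ)) u := by
    simpa using ((hasDerivAt_id u).const_mul (ρ*ξ)).const_sub κ
  have hq : HasDerivAt (fun u => (κ - ρ*ξ*u)^2 + u*(1-u)*ξ^2)
      (-(2*ρ*ξ*(κ - ρ*ξ*u)) + (1 - 2*u)*ξ^2) u := by
    refine ((hl.fun_pow 2).fun_add ((((hasDerivAt_id' u).fun_mul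
      ((hasDerivAt_id' u).const_sub 1))).mul_const (ξ^2))).congr_deriv ?_
    push_cast
    ring
  exact ((hl.fun_sub (hq.sqrt (Real.sqrt_pos.1 h).ne')).const_mul (mu κ θ ξ / 2)).deriv

lemma deriv_HH {κ θ ξ ρ v t u : ℝ} (hκθ : κ * θ ≠ 0)
    (hV : DifferentiableAt ℝ (VV κ θ ξ ρ) u) (hγ : DifferentiableAt ℝ (gam κ ξ ρ) u)
    (hD : κ*θ - 2 * bet κ ξ t * VV κ θ ξ ρ u ≠ 0) (hγ1 : 1 - gam κ ξ ρ u ≠ 0) :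
    deriv (HH κ θ ξ ρ v t) u =
      κ*θ*v*Real.exp (-(κ*t)) * deriv (VV κ θ ξ ρ) u
        / (κ*θ - 2 * bet κ ξ t * VV κ θ ξ ρ u)^2
      + 2 * bet κ ξ t * mu κ θ ξ * deriv (VV κ θ ξ ρ) u
        / (κ*θ - 2 * bet κ ξ t * VV κ θ ξ ρ u)
      - mu κ θ ξ * deriv (gam κ ξ ρ) u / (1 - gam κ ξ ρ u) := by
  have hV' := hV.hasDerivAt
  have hDD := (hV'.const_mul (2 * bet κ ξ t)).const_sub (κ*θ)
  have hg := (hγ.hasDerivAt.const_sub 1).const_mul (κ*θ)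
  have hden : κ*θ*(1 - gam κ ξ ρ u) ≠ 0 := mul_ne_zero hκθ hγ1
  have h := (((hV'.mul_const v).mul_const (Real.exp (-(κ*t)))).fun_div hDD hD).fun_sub
    (((hDD.fun_div hg hden).log (div_ne_zero hD hden)).const_mul (mu κ θ ξ))
  refine h.deriv.trans ?_
  have hDV : VV κ θ ξ ρ u * (2 * bet κ ξ t)
      = κ*θ - (κ*θ - 2 * bet κ ξ t * VV κ θ ξ ρ u) := by ring
  generalize κ*θ - 2 * bet κ ξ t * VV κ θ ξ ρ u = D at hDV hD ⊢
  generalize 1 - gam κ ξ ρ u = g at hγ1 ⊢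
  have hκ0 : κ ≠ 0 := left_ne_zero_of_mul hκθ
  have hθ0 : θ ≠ 0 := right_ne_zero_of_mul hκθ
  field_simp
  linear_combination (v * Real.exp (-(κ*t)) * g * deriv (VV κ θ ξ ρ) u) * hDV

theorem stmt11 (κ θ ξ ρ v t : ℝ) (hκ : 0 < κ) (hθ : 0 < θ) (hξ : 0 < ξ) (hv : 0 < v)
    (hρ₁ : -1 < ρ) (hρ₂ : ρ < 1) (ht : 0 < t) (hR2 : R2 κ ξ ρ t)
    (k : ℝ) (hk : deriv (VV κ θ ξ ρ) (ustarplus κ ξ ρ t) < k)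
    (ζsq a₁ a₂ : ℝ)
    (hζ : ζsq = 4 * bet κ ξ t * Real.sqrt
      (deriv (VV κ θ ξ ρ) (ustarplus κ ξ ρ t)
        * (k - deriv (VV κ θ ξ ρ) (ustarplus κ ξ ρ t))^3
        / (κ*θ*v*Real.exp (-(κ*t)))))
    (ha₁ : a₁ = -2*(k - deriv (VV κ θ ξ ρ) (ustarplus κ ξ ρ t)) / ζsq)
    (ha₂ : a₂ = mu κ θ ξ * Real.exp (-(κ*t)) / (16*(bet κ ξ t)^2)
      * (ξ^2*v*deriv (deriv (VV κ θ ξ ρ)) (ustarplus κ ξ ρ t)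
          - 8*(bet κ ξ t)^2*Real.exp (κ*t)*deriv (VV κ θ ξ ρ) (ustarplus κ ξ ρ t)
            *(k - deriv (VV κ θ ξ ρ) (ustarplus κ ξ ρ t)))
        / (deriv (VV κ θ ξ ρ) (ustarplus κ ξ ρ t)
            * (k - deriv (VV κ θ ξ ρ) (ustarplus κ ξ ρ t))^2))
    (τ₁ : ℝ) (uτ : ℝ → ℝ)
    (huτ : ∀ τ > τ₁, uτ τ ∈ interior (D2 κ ξ ρ t) ∧
      deriv (VV κ θ ξ ρ) (uτ τ) + deriv (HH κ θ ξ ρ v t) (uτ τ) / τ = k)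
    (hlim : Tendsto uτ atTop (nhds (ustarplus κ ξ ρ t))) :
    (fun τ : ℝ => uτ τ -
        (ustarplus κ ξ ρ t + a₁ * τ ^ (-(1:ℝ)/2) + a₂ * τ ^ (-(1:ℝ))))
      =O[atTop] fun τ : ℝ => τ ^ (-(3:ℝ)/2) := by
  obtain ⟨hd, hAd, hV'⟩ := ustarplus_spec hκ hξ ht hR2.2
  have hE1 : 1 < Real.exp (κ*t) := Real.one_lt_exp_iff.2 (by positivity)
  have hEexp : Real.exp (-(κ*t)) = (Real.exp (κ*t))⁻¹ := Real.exp_neg _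
  have hβ : bet κ ξ t = ξ^2/(4*κ) * (1 - Real.exp (-(κ*t))) := rfl
  have hμ : mu κ θ ξ = 2*κ*θ/ξ^2 := rfl
  have hVw : VV κ θ ξ ρ (ustarplus κ ξ ρ t) = mu κ θ ξ / 2 * (κ - ρ*ξ*ustarplus κ ξ ρ t
    - dd κ ξ ρ (ustarplus κ ξ ρ t)) := rfl
  generalize hwdef : ustarplus κ ξ ρ t = w at *
  generalize hE : Real.exp (κ*t) = E at *
  have hEm : 0 < E - 1 := by linarith
  have hE0 : 0 < E := by linarith
  have hβ0 : 0 < bet κ ξ t := by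
    rw [hβ, hEexp]
    exact mul_pos (by positivity) (sub_pos.2 (inv_lt_one_of_one_lt₀ hE1))
  have hμ0 : 0 < mu κ θ ξ := by rw [hμ]; positivity
  have hDw : κ*θ = 2 * bet κ ξ t * VV κ θ ξ ρ w := by
    rw [hVw, hAd, hβ, hμ, hEexp]
    field_simp
    norm_num
  have hA0 : 0 < κ - ρ*ξ*w + dd κ ξ ρ w := by
    have : 0 < 2*κ*E/(E-1) := by positivity
    linarith
  have hVan := analyticAt_VV (θ := θ) hd
  have hgan := analyticAt_gam hd hA0.ne'
  have hSan := analyticAt_dslope_self hVan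
  have hV1 : 0 < deriv (VV κ θ ξ ρ) w := by
    rw [deriv_VV hd]
    refine mul_pos (by positivity) ?_
    have hA : κ - ρ*ξ*w = dd κ ξ ρ w + 2*κ*E/(E-1) := by linarith
    have h : -(ρ*ξ) - (-(2*ρ*ξ*(κ - ρ*ξ*w)) + (1 - 2*w)*ξ^2) / (2 * dd κ ξ ρ w)
        = ξ * ((2*w - 1) * (ξ*(E - 1)) + 4*κ*ρ*E) / ((E - 1) * (2 * dd κ ξ ρ w)) := by
      rw [hA]
      field_simp
      ring
    rw [h]
    exact div_pos (mul_pos hξ (by linarith)) (by positivity)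
  have hγw : 1 - gam κ ξ ρ w ≠ 0 := by
    have : 1 - gam κ ξ ρ w = 2 * dd κ ξ ρ w / (κ - ρ*ξ*w + dd κ ξ ρ w) := by
      rw [gam]
      field_simp
      ring
    rw [this]
    positivity
  have hSw : dslope (VV κ θ ξ ρ) w w = deriv (VV κ θ ξ ρ) w := dslope_same _ _
  have hV2 := deriv_deriv_eq_two_mul_deriv_dslope hVan
  set S := dslope (VV κ θ ξ ρ) w with hS
  set V' := deriv (VV κ θ ξ ρ) with hV'def
  set γ := gam κ ξ ρ with hγdef
  set β := bet κ ξ t with hβdef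
  set m := mu κ θ ξ with hm
  obtain ⟨c, hc⟩ : ∃ c, c = κ*θ*v*Real.exp (-(κ*t)) := ⟨_, rfl⟩
  have hc0 : 0 < c := by rw [hc]; positivity
  have hk1 : 0 < k - V' w := sub_pos.2 hk
  let P : ℝ → ℝ := fun u => c * V' u / (2 * β * S u)^2
  let M : ℝ → ℝ := fun u => m * V' u / S u - (w - u) * (m * deriv γ u / (1 - γ u))
  let G : ℝ → ℝ := fun u => (P u + (w - u) * M u) / (k - V' u)
  have hV'an : AnalyticAt ℝ V' w := hVan.deriv
  have hγ'an : AnalyticAt ℝ (deriv γ) w := hgan.deriv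
  have hSw0 : S w ≠ 0 := by rw [hSw]; exact hV1.ne'
  have hPan : AnalyticAt ℝ P w :=
    AnalyticAt.div (by fun_prop) (by fun_prop)
      (pow_ne_zero _ (mul_ne_zero (by positivity) hSw0))
  have hMan : AnalyticAt ℝ M w :=
    AnalyticAt.sub (AnalyticAt.div (by fun_prop) (by fun_prop) hSw0)
      (AnalyticAt.mul (by fun_prop) (AnalyticAt.div (by fun_prop) (by fun_prop) hγw))
  have hGan : AnalyticAt ℝ G w :=
    AnalyticAt.div (by fun_prop) (by fun_prop) hk1.ne'
  have hGw : G w = c / (4 * β^2 * V' w * (k - V' w)) := by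
    simp only [G, P, hSw]
    field_simp
    ring
  have hG0 : 0 < G w := by rw [hGw]; positivity
  have hP' : HasDerivAt P 0 w := by
    have h := (hV'an.differentiableAt.hasDerivAt.const_mul c).fun_div
      ((hSan.differentiableAt.hasDerivAt.const_mul (2 * β)).fun_pow 2)
      (pow_ne_zero _ (mul_ne_zero (by positivity) hSw0))
    refine h.congr_deriv ?_
    rw [hV2, hSw, div_eq_zero_iff]
    left
    push_cast
    ring
  have hG' : deriv G w = (-m * (k - V' w) + c * deriv V' w / (4 * β^2 * V' w))
      / (k - V' w)^2 := by
    have h := (hP'.fun_add (((hasDerivAt_id' w).const_sub w).fun_mul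
      hMan.differentiableAt.hasDerivAt)).fun_div
      (hV'an.differentiableAt.hasDerivAt.const_sub k) hk1.ne'
    rw [h.deriv]
    simp only [P, M, hSw]
    field_simp
    ring
  have hlt : ∀ᶠ τ in atTop, uτ τ < w := by
    filter_upwards [eventually_gt_atTop τ₁] with τ hτ
    have := interior_subset (huτ τ hτ).1
    rw [D2, hwdef] at this
    exact this.2
  have heq : ∀ᶠ τ in atTop, τ * (w - uτ τ) ^ 2 = G (uτ τ) := by
    have hev : ∀ᶠ u in nhds w, AnalyticAt ℝ (VV κ θ ξ ρ) u ∧ AnalyticAt ℝ γ u ∧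
        S u ≠ 0 ∧ 1 - γ u ≠ 0 ∧ k - V' u ≠ 0 :=
      hVan.eventually_analyticAt.and (hgan.eventually_analyticAt.and
        ((hSan.continuousAt.eventually_ne hSw0).and
          (((continuousAt_const.sub hgan.continuousAt).eventually_ne hγw).and
            ((continuousAt_const.sub hV'an.continuousAt).eventually_ne hk1.ne'))))
    filter_upwards [hlim.eventually hev, hlt, eventually_gt_atTop τ₁, eventually_gt_atTop 0]
      with τ ⟨h1, h2, h3, h4, h5⟩ h6 h7 h8
    have hsol := (huτ τ h7).2
    generalize uτ τ = u at *
    have hwu : w - u ≠ 0 := (sub_pos.2 h6).ne'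
    have hD : κ*θ - 2 * β * VV κ θ ξ ρ u = 2 * β * ((w - u) * S u) := by
      rw [hDw, eq_add_mul_dslope (VV κ θ ξ ρ) w u]
      ring
    rw [deriv_HH (by positivity) h1.differentiableAt h2.differentiableAt
      (by rw [← hβdef, hD]; exact mul_ne_zero (by positivity) (mul_ne_zero hwu h3)) h4,
      ← hβdef, hD, ← hc, ← hV'def, ← hγdef, ← hm] at hsol
    have hH : τ * (k - V' u) * (w - u)^2 = P u + (w - u) * M u := by
      rw [← hsol]
      simp only [P, M]
      field_simp
      ring
    rw [eq_div_iff h5, ← hH]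
    ring
  have hmain := isBigO_of_mul_sq_eq hGan hG0 hlim hlt heq
  have ha₁' : a₁ = -√(G w) := by
    have hsq : √(V' w * (k - V' w)^3 / c) * √(G w) = (k - V' w) / (2 * β) := by
      rw [← Real.sqrt_mul (by positivity), hGw, ← Real.sqrt_sq (by positivity :
        0 ≤ (k - V' w) / (2 * β))]
      congr 1
      field_simp
      ring
    have hq0 : 0 < √(V' w * (k - V' w)^3 / c) := Real.sqrt_pos.2 (by positivity)
    rw [ha₁, hζ, ← hc, div_eq_iff (by positivity)]
    rw [eq_div_iff (by positivity)] at hsq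
    linear_combination 2 * hsq
  have ha₂' : a₂ = deriv G w / 2 := by
    have hc' : c = m * ξ^2 / 2 * (v * Real.exp (-(κ*t))) := by rw [hc, hμ]; field_simp
    rw [ha₂, hG', hc', hEexp]
    field_simp
    ring
  refine hmain.congr_left fun τ => ?_
  rw [ha₁', ha₂']
  ring

end Heston
end
end
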